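/- Let G be a finite abelian group, k a field whose characteristic does not divide |G|, and V a nontrivial finite-dimensional representation of G over k. Let m be the number of distinct nontrivial characters occurring in the base change of V to an algebraic closure of k, and let τ be the number of involutions (elements of order 2) in G. If m > τ, then γ^r(G,V) ≥ 3. -/

import Mathlib

open MvPolynomial

noncomputable section

variable {k : Type} [Field k] {N : ℕ} {G : Type}

def mAct (M : Matrix (Fin N) (Fin N) k) :
    MvPolynomial (Fin N) k →ₐ[k] MvPolynomial (Fin N) k :=
  aeval fun i => ∑ j, C (M i j) * X j

lemma mAct_comp (A B : Matrix (Fin N) (Fin N) k) :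
    (mAct A).comp (mAct B) = mAct (B * A) := by
  apply MvPolynomial.algHom_ext
  intro i
  simp only [mAct, AlgHom.comp_apply, aeval_X, map_sum, map_mul, aeval_C, algebraMap_eq,
    Finset.mul_sum, Matrix.mul_apply, Finset.sum_mul]
  rw [Finset.sum_comm]
  simp [mul_assoc]

lemma mAct_one : mAct (1 : Matrix (Fin N) (Fin N) k) = AlgHom.id k _ := by
  apply MvPolynomial.algHom_ext
  intro i
  simp [mAct, Matrix.one_apply, ite_mul, apply_ite C]

def mEquiv (M : GL (Fin N) k) :
    MvPolynomial (Fin N) k ≃ₐ[k] MvPolynomial (Fin N) k :=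
  AlgEquiv.ofAlgHom (mAct (M : Matrix (Fin N) (Fin N) k))
    (mAct ((M⁻¹ : GL (Fin N) k) : Matrix (Fin N) (Fin N) k))
    (by rw [mAct_comp, Units.inv_mul, mAct_one])
    (by rw [mAct_comp, Units.mul_inv, mAct_one])

def fAct (M : GL (Fin N) k) :
    FractionRing (MvPolynomial (Fin N) k) ≃+* FractionRing (MvPolynomial (Fin N) k) :=
  IsFractionRing.ringEquivOfRingEquiv (mEquiv M).toRingEquiv

/-- `f` is an invariant rational function for the linear action `ρ`. -/
def IsInv (ρ : G → GL (Fin N) k) (f : FractionRing (MvPolynomial (Fin N) k)) : Prop :=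
  ∀ g, fAct (ρ g) f = f

/-- `f`, written as a quotient `f₁/f₂` of coprime polynomials, has
`deg f = deg f₁ + deg f₂ ≤ d`. -/
def RDegLE (f : FractionRing (MvPolynomial (Fin N) k)) (d : ℕ) : Prop :=
  ∃ f₁ f₂ : MvPolynomial (Fin N) k, f₂ ≠ 0 ∧
    (∀ p : MvPolynomial (Fin N) k, p ∣ f₁ → p ∣ f₂ → IsUnit p) ∧
    f = algebraMap (MvPolynomial (Fin N) k) (FractionRing (MvPolynomial (Fin N) k)) f₁ /
        algebraMap (MvPolynomial (Fin N) k) (FractionRing (MvPolynomial (Fin N) k)) f₂ ∧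
    f₁.totalDegree + f₂.totalDegree ≤ d

/-- `f` is (the image in `k(V)` of) a polynomial of degree at most `d`. -/
def PDegLE (f : FractionRing (MvPolynomial (Fin N) k)) (d : ℕ) : Prop :=
  ∃ p : MvPolynomial (Fin N) k, p.totalDegree ≤ d ∧
    f = algebraMap (MvPolynomial (Fin N) k) (FractionRing (MvPolynomial (Fin N) k)) p

/-- `β^r(G,V)`: the least `d` such that the invariant rational functions of degree at most `d`
generate the invariant field over `k`. -/
def betaR (ρ : G → GL (Fin N) k) : ℕ :=
  sInf {d : ℕ | ∀ f, IsInv ρ f →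
    f ∈ IntermediateField.adjoin k {h | IsInv ρ h ∧ RDegLE h d}}

/-- `β(G,V)`: the least `d` such that the invariant polynomials of degree at most `d`
generate the invariant field over `k`. -/
def betaP (ρ : G → GL (Fin N) k) : ℕ :=
  sInf {d : ℕ | ∀ f, IsInv ρ f →
    f ∈ IntermediateField.adjoin k {h | IsInv ρ h ∧ PDegLE h d}}

/-- `γ^r(G,V)`: the least `d` such that the invariant rational functions of degree at most `d`
contain a transcendence basis for the invariant field over `k`. -/
def gammaR (ρ : G → GL (Fin N) k) : ℕ :=
  sInf {d : ℕ | ∃ s : Set (FractionRing (MvPolynomial (Fin N) k)),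
    (∀ f ∈ s, IsInv ρ f ∧ RDegLE f d) ∧
    AlgebraicIndependent k ((↑) : s → FractionRing (MvPolynomial (Fin N) k)) ∧
    ∀ f, IsInv ρ f → IsAlgebraic (IntermediateField.adjoin k s) f}

/-- `γ(G,V)`: the least `d` such that the invariant polynomials of degree at most `d`
contain a transcendence basis for the invariant field over `k`. -/
def gammaP (ρ : G → GL (Fin N) k) : ℕ :=
  sInf {d : ℕ | ∃ s : Set (FractionRing (MvPolynomial (Fin N) k)),
    (∀ f ∈ s, IsInv ρ f ∧ PDegLE f d) ∧
    AlgebraicIndependent k ((↑) : s → FractionRing (MvPolynomial (Fin N) k)) ∧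
    ∀ f, IsInv ρ f → IsAlgebraic (IntermediateField.adjoin k s) f}

/-- The character `χ : G → Lˣ` occurs in the base change to `L` of the representation `ρ`,
i.e. its eigenspace in `L ⊗ V` is nonzero. -/
def Occurs {L : Type} [Field L] [Algebra k L] [Monoid G] (ρ : G → GL (Fin N) k)
    (χ : G →* Lˣ) : Prop :=
  ∃ v : Fin N → L, v ≠ 0 ∧
    ∀ g, ((ρ g : Matrix (Fin N) (Fin N) k).map (algebraMap k L)).mulVec v = (χ g : L) • v

section P1

variable {L B G : Type} [Field L] [Ring B] [Algebra L B] [CommGroup G] [Fintype G]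

noncomputable def idm (r : G →* B) (χ : G →* Lˣ) : B :=
  (Fintype.card G : L)⁻¹ • ∑ g, ((χ g⁻¹ : Lˣ) : L) • r g

noncomputable def tor (r : G →* B) (χ : G →* Lˣ) (t : L) : B :=
  1 + (t - 1) • idm r χ + (t⁻¹ - 1) • idm r χ⁻¹

lemma idm_mul_r (r : G →* B) (χ : G →* Lˣ) (h : G) :
    idm r χ * r h = ((χ h : Lˣ) : L) • idm r χ := by
  unfold idm
  rw [smul_mul_assoc, smul_comm (((χ h : Lˣ) : L)), Finset.sum_mul, Finset.smul_sum (r := ((χ h : Lˣ) : L))]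
  congr 1
  rw [← Equiv.sum_comp (Equiv.mulRight h) (fun g => ((χ h : Lˣ) : L) • ((χ g⁻¹ : Lˣ) : L) • r g)]
  apply Finset.sum_congr rfl
  intro g _
  simp only [Equiv.coe_mulRight, smul_mul_assoc, map_mul, mul_inv_rev, smul_smul, ← Units.val_mul]
  simp

lemma r_mul_idm (r : G →* B) (χ : G →* Lˣ) (h : G) :
    r h * idm r χ = ((χ h : Lˣ) : L) • idm r χ := by
  rw [← idm_mul_r]
  unfold idm
  simp only [mul_smul_comm, smul_mul_assoc, Finset.mul_sum, Finset.sum_mul, ← map_mul, mul_comm]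

lemma char_sum (χ : G →* Lˣ) (h : χ ≠ 1) : ∑ g, ((χ g : Lˣ) : L) = 0 := by
  obtain ⟨g, hg⟩ : ∃ g, χ g ≠ 1 := by
    by_contra hh; push Not at hh; exact h (MonoidHom.ext hh)
  have := Equiv.sum_comp (Equiv.mulLeft g) (fun x => ((χ x : Lˣ) : L))
  simp only [Equiv.coe_mulLeft, map_mul, Units.val_mul, ← Finset.mul_sum] at this
  have h2 : (((χ g : Lˣ) : L) - 1) * ∑ g, ((χ g : Lˣ) : L) = 0 := by rw [sub_mul, this]; ring
  rcases mul_eq_zero.1 h2 with h3 | h3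
  · exact absurd (Units.ext (sub_eq_zero.1 h3)) hg
  · exact h3

lemma idm_mul_idm_self (hc : (Fintype.card G : L) ≠ 0) (r : G →* B) (χ : G →* Lˣ) :
    idm r χ * idm r χ = idm r χ := by
  conv_lhs => enter [2]; unfold idm
  simp only [mul_smul_comm, Finset.mul_sum, idm_mul_r, smul_smul, ← Units.val_mul, ← map_mul,
    inv_mul_cancel, map_one]
  simp only [Units.val_one, one_smul, Finset.sum_const, Finset.card_univ]
  rw [← Nat.cast_smul_eq_nsmul L, smul_smul, inv_mul_cancel₀ hc, one_smul]

lemma idm_mul_idm_ne (r : G →* B) (χ ψ : G →* Lˣ) (h : χ ≠ ψ) :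
    idm r χ * idm r ψ = 0 := by
  conv_lhs => enter [2]; unfold idm
  simp only [mul_smul_comm, Finset.mul_sum, idm_mul_r, smul_smul, ← Units.val_mul]
  rw [← Finset.sum_smul]
  have := char_sum (χ := ψ⁻¹ * χ) (by
    intro h2; apply h; ext g
    have := DFunLike.congr_fun h2 g
    simp only [MonoidHom.mul_apply, MonoidHom.inv_apply, MonoidHom.one_apply, inv_mul_eq_one] at this
    rw [this])
  simp only [MonoidHom.mul_apply, MonoidHom.inv_apply] at this
  simp only [map_inv, this, zero_smul, smul_zero]

lemma tor_mul_tor (hc : (Fintype.card G : L) ≠ 0) (r : G →* B) (χ : G →* Lˣ) (h : χ ≠ χ⁻¹)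
    (t : L) (ht : t ≠ 0) : tor r χ t * tor r χ t⁻¹ = 1 := by
  have h1 := idm_mul_idm_self hc r χ
  have h2 := idm_mul_idm_self hc r χ⁻¹
  have h3 := idm_mul_idm_ne r χ χ⁻¹ h
  have h4 := idm_mul_idm_ne r χ⁻¹ χ h.symm
  unfold tor
  simp only [mul_add, add_mul, mul_one, one_mul, smul_mul_smul_comm, h1, h2, h3, h4, smul_zero,
    inv_inv]
  have e1 : (t - 1) * (t⁻¹ - 1) = - (t - 1) - (t⁻¹ - 1) := by field_simp; ring
  have e2 : (t⁻¹ - 1) * (t - 1) = - (t - 1) - (t⁻¹ - 1) := by field_simp; ring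
  rw [e1, e2]
  module

lemma r_comm_tor (r : G →* B) (χ : G →* Lˣ) (t : L) (g : G) :
    r g * tor r χ t = tor r χ t * r g := by
  simp [tor, mul_add, add_mul, r_mul_idm, idm_mul_r]

lemma exists_char {k : Type} [Field k] (hchar : (Fintype.card G : k) ≠ 0)
    (S : Set (G →* (AlgebraicClosure k)ˣ))
    (h : {g : G | orderOf g = 2}.ncard < {χ | χ ≠ 1 ∧ χ ∈ S}.ncard) :
    ∃ χ ∈ S, χ ≠ χ⁻¹ := by
  by_contra hh
  push Not at hh
  have : NeZero (Nat.card G : AlgebraicClosure k) := ⟨by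
    rw [Nat.card_eq_fintype_card, ← map_natCast (algebraMap k _)]
    exact (map_ne_zero (algebraMap k (AlgebraicClosure k))).2 hchar⟩
  have : NeZero ((Monoid.exponent G : ℕ) : AlgebraicClosure k) := ⟨by
    intro h0
    obtain ⟨c, hc⟩ := Group.exponent_dvd_nat_card (G := G)
    apply NeZero.ne (Nat.card G : AlgebraicClosure k)
    rw [hc, Nat.cast_mul, h0, zero_mul]⟩
  obtain ⟨e⟩ := CommGroup.monoidHom_mulEquiv_of_hasEnoughRootsOfUnity G (AlgebraicClosure k)
  have : {χ | χ ≠ 1 ∧ χ ∈ S}.ncard ≤ {g : G | orderOf g = 2}.ncard := by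
    apply Set.ncard_le_ncard_of_injOn e
    · rintro χ ⟨h1, h2⟩
      have h3 := hh χ h2
      have : orderOf χ = 2 := by
        apply orderOf_eq_prime _ h1
        rw [pow_two]; nth_rewrite 2 [h3]; simp
      simpa using this
    · exact e.injective.injOn
  omega
end P1
section P2
variable {L G : Type} [Field L] [CommGroup G] [Fintype G] {N : ℕ}

/-- the action on polynomials as linear endomorphisms -/
noncomputable def rP (ρ : G →* GL (Fin N) L) : G →* Module.End L (MvPolynomial (Fin N) L) where
  toFun g := (mAct (ρ g : Matrix (Fin N) (Fin N) L)).toLinearMap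
  map_one' := by
    rw [map_one, Units.val_one, mAct_one]; rfl
  map_mul' a b := by
    rw [mul_comm, map_mul, Units.val_mul, ← mAct_comp]; rfl

noncomputable def rM (ρ : G →* GL (Fin N) L) : G →* Matrix (Fin N) (Fin N) L :=
  (Units.coeHom _).comp ρ

lemma rP_mul (ρ : G →* GL (Fin N) L) (g : G) (p q : MvPolynomial (Fin N) L) :
    rP ρ g (p * q) = rP ρ g p * rP ρ g q := by
  simp [rP]

lemma mAct_X (M : Matrix (Fin N) (Fin N) L) (i : Fin N) :
    mAct M (X i) = ∑ j, M i j • X j := by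
  simp [mAct, smul_eq_C_mul]

noncomputable def linX (i : Fin N) : Matrix (Fin N) (Fin N) L →ₗ[L] MvPolynomial (Fin N) L where
  toFun M := mAct M (X i)
  map_add' A B := by simp [mAct_X, add_smul, Finset.sum_add_distrib]
  map_smul' c A := by simp [mAct_X, mul_smul, Finset.smul_sum]

lemma mAct_idm_X (ρ : G →* GL (Fin N) L) (χ : G →* Lˣ) (i : Fin N) :
    mAct (idm (rM ρ) χ) (X i) = idm (rP ρ) χ (X i) := by
  change linX i _ = _
  simp only [idm, map_smul, map_sum, LinearMap.smul_apply, LinearMap.sum_apply]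
  rfl

lemma mAct_tor_X (ρ : G →* GL (Fin N) L) (χ : G →* Lˣ) (t : L) (i : Fin N) :
    mAct (tor (rM ρ) χ t) (X i) = tor (rP ρ) χ t (X i) := by
  change linX i _ = _
  simp only [tor, map_add, map_smul, LinearMap.add_apply, LinearMap.smul_apply]
  rw [← mAct_idm_X, ← mAct_idm_X]
  congr 2
  change mAct 1 (X i) = _
  rw [mAct_one]; rfl

lemma idm_one (ρ : G →* GL (Fin N) L) (χ : G →* Lˣ) (h : χ ≠ 1) :
    idm (rP ρ) χ 1 = 0 := by
  have h2 : χ⁻¹ ≠ 1 := by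
    intro h2; apply h; ext g
    have := DFunLike.congr_fun h2 g
    simp only [MonoidHom.inv_apply, MonoidHom.one_apply, inv_eq_one] at this
    rw [this]; rfl
  have := char_sum _ h2
  simp only [MonoidHom.inv_apply] at this
  have e : ∀ g, rP ρ g 1 = 1 := fun g => map_one (mAct _)
  simp only [idm, LinearMap.smul_apply, LinearMap.sum_apply, e, map_inv]
  rw [← Finset.sum_smul, this, zero_smul, smul_zero]

lemma tor_one (ρ : G →* GL (Fin N) L) (χ : G →* Lˣ) (h : χ ≠ χ⁻¹) (t : L) :
    tor (rP ρ) χ t 1 = 1 := by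
  have h1 : χ ≠ 1 := by rintro rfl; exact h (by ext g; simp)
  have h2 : χ⁻¹ ≠ 1 := by
    intro h2; apply h1; ext g
    have := DFunLike.congr_fun h2 g
    simp only [MonoidHom.inv_apply, MonoidHom.one_apply, inv_eq_one] at this
    rw [this]; rfl
  simp [tor, idm_one, h1, h2]

lemma deg_le_one_monomial (d : Fin N →₀ ℕ) (hd : d.degree ≤ 1) : d = 0 ∨ ∃ i, d = Finsupp.single i 1 := by
  by_cases h : d = 0
  · exact Or.inl h
  · right
    obtain ⟨i, hi⟩ : ∃ i, d i ≠ 0 := by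
      by_contra hh; push Not at hh; exact h (Finsupp.ext hh)
    refine ⟨i, ?_⟩
    have h1 : Finsupp.single i 1 ≤ d := by
      rw [Finsupp.single_le_iff]; omega
    obtain ⟨e, he⟩ := exists_add_of_le h1
    have : e.degree = 0 := by
      have := congrArg Finsupp.degree he
      rw [map_add, Finsupp.degree_single] at this; omega
    rw [Finsupp.degree_eq_zero_iff] at this
    rw [he, this, add_zero]

lemma deg_le_two_monomial (d : Fin N →₀ ℕ) (hd : d.degree ≤ 2) :
    ∃ d₁ d₂ : Fin N →₀ ℕ, d = d₁ + d₂ ∧ d₁.degree ≤ 1 ∧ d₂.degree ≤ 1 := by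
  by_cases h : d = 0
  · exact ⟨0, 0, by simp [h], by simp, by simp⟩
  · obtain ⟨i, hi⟩ : ∃ i, d i ≠ 0 := by
      by_contra hh; push Not at hh; exact h (Finsupp.ext hh)
    have h1 : Finsupp.single i 1 ≤ d := by
      rw [Finsupp.single_le_iff]; omega
    obtain ⟨e, he⟩ := exists_add_of_le h1
    refine ⟨_, e, he, by simp, ?_⟩
    have := congrArg Finsupp.degree he
    rw [map_add, Finsupp.degree_single] at this; omega

lemma mAct_tor_mono (ρ : G →* GL (Fin N) L) (χ : G →* Lˣ) (h : χ ≠ χ⁻¹) (t : L)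
    (d : Fin N →₀ ℕ) (hd : d.degree ≤ 1) :
    mAct (tor (rM ρ) χ t) (monomial d 1) = tor (rP ρ) χ t (monomial d 1) := by
  rcases deg_le_one_monomial d hd with rfl | ⟨i, rfl⟩
  · change mAct _ 1 = tor (rP ρ) χ t 1
    rw [tor_one _ _ h, map_one]
  · exact mAct_tor_X ρ χ t i

lemma lin_ext {M : Type} [AddCommGroup M] [Module L M] (S T : MvPolynomial (Fin N) L →ₗ[L] M)
    (n : ℕ) (h : ∀ d : Fin N →₀ ℕ, d.degree ≤ n → S (monomial d 1) = T (monomial d 1))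
    (p : MvPolynomial (Fin N) L) (hp : p.totalDegree ≤ n) : S p = T p := by
  rw [p.as_sum, map_sum, map_sum]
  apply Finset.sum_congr rfl
  intro d hd
  have : monomial d (coeff d p) = (coeff d p) • (monomial d (1 : L)) := by
    rw [smul_monomial, smul_eq_mul, mul_one]
  rw [this, map_smul, map_smul, h d]
  exact (le_totalDegree hd).trans hp

lemma mAct_tor (ρ : G →* GL (Fin N) L) (χ : G →* Lˣ) (h : χ ≠ χ⁻¹) (t : L)
    (p : MvPolynomial (Fin N) L) (hp : p.totalDegree ≤ 1) :
    mAct (tor (rM ρ) χ t) p = tor (rP ρ) χ t p :=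
  lin_ext (mAct (tor (rM ρ) χ t)).toLinearMap _ 1 (mAct_tor_mono ρ χ h t) p hp

/-- semi-invariants of degree one -/
lemma tor_semi (ρ : G →* GL (Fin N) L) (χ : G →* Lˣ) (h : χ ≠ χ⁻¹) (t : L) (c : G → L) :
    ∃ l : L, ∀ p : MvPolynomial (Fin N) L, p.totalDegree ≤ 1 →
      (∀ g, mAct (ρ g : Matrix _ _ L) p = c g • p) → mAct (tor (rM ρ) χ t) p = l • p := by
  have key : ∀ χ : G →* Lˣ, ∃ l : L, ∀ p : MvPolynomial (Fin N) L,
      (∀ g, mAct (ρ g : Matrix _ _ L) p = c g • p) → idm (rP ρ) χ p = l • p := by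
    intro χ
    refine ⟨(Fintype.card G : L)⁻¹ * ∑ g, ((χ g⁻¹ : Lˣ) : L) * c g, ?_⟩
    intro p hp
    have e : ∀ g, rP ρ g p = c g • p := hp
    simp only [idm, LinearMap.smul_apply, LinearMap.sum_apply, e, mul_smul,
      Finset.sum_smul]
  obtain ⟨l1, h1⟩ := key χ
  obtain ⟨l2, h2⟩ := key χ⁻¹
  refine ⟨1 + (t - 1) * l1 + (t⁻¹ - 1) * l2, ?_⟩
  intro p hp hc
  rw [mAct_tor ρ χ h t p hp]
  simp only [tor, LinearMap.add_apply, LinearMap.smul_apply, h1 p hc, h2 p hc, add_smul, mul_smul,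
    one_smul, Module.End.one_apply]

lemma R_adj (ρ : G →* GL (Fin N) L) (χ : G →* Lˣ) (p q : MvPolynomial (Fin N) L) :
    idm (rP ρ) (1 : G →* Lˣ) (idm (rP ρ) χ p * q) =
    idm (rP ρ) (1 : G →* Lˣ) (p * idm (rP ρ) χ⁻¹ q) := by
  have key : ∀ g, idm (rP ρ) (1 : G →* Lˣ) (rP ρ g p * q) =
      idm (rP ρ) (1 : G →* Lˣ) (p * rP ρ g⁻¹ q) := by
    intro g
    have e1 : rP ρ g p * q = rP ρ g (p * rP ρ g⁻¹ q) := by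
      rw [rP_mul, ← Module.End.mul_apply, ← map_mul, mul_inv_cancel, map_one]; rfl
    rw [e1, ← Module.End.mul_apply, idm_mul_r]
    simp
  conv_lhs => enter [2, 1]; unfold idm
  conv_rhs => enter [2, 2]; unfold idm
  simp only [LinearMap.smul_apply, LinearMap.sum_apply, smul_mul_assoc, mul_smul_comm, map_smul,
    map_sum, Finset.sum_mul, Finset.mul_sum, key]
  refine congrArg _ ?_
  refine Fintype.sum_equiv (Equiv.inv G) _ _ ?_
  intro g
  simp only [Equiv.inv_apply, inv_inv, map_inv, MonoidHom.inv_apply]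

lemma R_adj_tor (ρ : G →* GL (Fin N) L) (χ : G →* Lˣ) (t : L) (p q : MvPolynomial (Fin N) L) :
    idm (rP ρ) (1 : G →* Lˣ) (tor (rP ρ) χ t p * q) =
    idm (rP ρ) (1 : G →* Lˣ) (p * tor (rP ρ) χ t⁻¹ q) := by
  simp only [tor, LinearMap.add_apply, LinearMap.smul_apply, add_mul, mul_add, map_add,
    smul_mul_assoc, mul_smul_comm, map_smul, R_adj, inv_inv, Module.End.one_apply]
  abel

lemma mAct_tor_R (ρ : G →* GL (Fin N) L) (χ ψ : G →* Lˣ) (t : L) (p : MvPolynomial (Fin N) L) :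
    mAct (tor (rM ρ) χ t) (idm (rP ρ) ψ p) = idm (rP ρ) ψ (mAct (tor (rM ρ) χ t) p) := by
  have : ∀ g, mAct (tor (rM ρ) χ t) (rP ρ g p) = rP ρ g (mAct (tor (rM ρ) χ t) p) := by
    intro g
    change ((mAct (tor (rM ρ) χ t)).comp (mAct (rM ρ g))) p =
      ((mAct (rM ρ g)).comp (mAct (tor (rM ρ) χ t))) p
    rw [mAct_comp, mAct_comp, r_comm_tor]
  simp only [idm, LinearMap.smul_apply, LinearMap.sum_apply, map_smul, map_sum, this]

lemma tor_inv (hc : (Fintype.card G : L) ≠ 0) (ρ : G →* GL (Fin N) L) (χ : G →* Lˣ)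
    (h : χ ≠ χ⁻¹) (t : L) (ht : t ≠ 0) (p : MvPolynomial (Fin N) L) (hp : p.totalDegree ≤ 2)
    (hi : ∀ g, mAct (ρ g : Matrix _ _ L) p = p) : mAct (tor (rM ρ) χ t) p = p := by
  have hR : idm (rP ρ) (1 : G →* Lˣ) p = p := by
    have e : ∀ g, rP ρ g p = p := hi
    simp only [idm, LinearMap.smul_apply, LinearMap.sum_apply, e, MonoidHom.one_apply,
      Units.val_one, one_smul, Finset.sum_const, Finset.card_univ]
    rw [← Nat.cast_smul_eq_nsmul L, smul_smul, inv_mul_cancel₀ hc, one_smul]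
  have := lin_ext ((mAct (tor (rM ρ) χ t)).toLinearMap ∘ₗ idm (rP ρ) (1 : G →* Lˣ))
    (idm (rP ρ) (1 : G →* Lˣ)) 2 ?_ p hp
  · simpa [hR] using this
  intro d hd
  obtain ⟨d₁, d₂, rfl, h1, h2⟩ := deg_le_two_monomial d hd
  have e : (monomial (d₁ + d₂) (1 : L)) = monomial d₁ 1 * monomial d₂ 1 := by simp
  have h3 := tor_mul_tor hc (rP ρ) χ h t⁻¹ (inv_ne_zero ht)
  rw [inv_inv] at h3
  simp only [LinearMap.comp_apply, AlgHom.toLinearMap_apply]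
  rw [e, mAct_tor_R, map_mul, mAct_tor_mono ρ χ h t _ h1, mAct_tor_mono ρ χ h t _ h2, R_adj_tor,
    ← Module.End.mul_apply, h3]
  rfl

noncomputable def torGL (hc : (Fintype.card G : L) ≠ 0) (ρ : G →* GL (Fin N) L) (χ : G →* Lˣ)
    (h : χ ≠ χ⁻¹) (t : Lˣ) : GL (Fin N) L where
  val := tor (rM ρ) χ t
  inv := tor (rM ρ) χ (t : L)⁻¹
  val_inv := tor_mul_tor hc _ _ h _ t.ne_zero
  inv_val := by
    have := tor_mul_tor hc (rM ρ) _ h _ (inv_ne_zero t.ne_zero)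
    rwa [inv_inv] at this

/-- a weight vector -/
lemma exists_weight (hc : (Fintype.card G : L) ≠ 0) (ρ : G →* GL (Fin N) L) (χ : G →* Lˣ)
    (h : χ ≠ χ⁻¹) (v : Fin N → L) (hv : v ≠ 0)
    (hev : ∀ g, (ρ g : Matrix _ _ L).mulVec v = (χ g : L) • v) :
    ∃ u : Fin N → L, u ≠ 0 ∧ ∀ t : L,
      mAct (tor (rM ρ) χ t) (∑ j, u j • X j) = t • (∑ j, u j • X j) := by
  have e1 : (idm (rM ρ) χ).mulVec v = v := by
    have e : ∀ g, (rM ρ g).mulVec v = (χ g : L) • v := hev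
    simp only [idm, Matrix.smul_mulVec, Matrix.sum_mulVec, e, smul_smul, ← Units.val_mul,
      ← map_mul, inv_mul_cancel, map_one]
    simp only [Units.val_one, one_smul, Finset.sum_const, Finset.card_univ]
    rw [← Nat.cast_smul_eq_nsmul L, smul_smul, inv_mul_cancel₀ hc, one_smul]
  obtain ⟨i, hi⟩ : ∃ i, idm (rM ρ) χ i ≠ 0 := by
    by_contra hh
    push Not at hh
    apply hv
    rw [← e1]
    have : idm (rM ρ) χ = 0 := by ext i j; rw [hh i]; rfl
    rw [this, Matrix.zero_mulVec]
  refine ⟨_, hi, ?_⟩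
  intro t
  have e2 : (∑ j, (idm (rM ρ) χ i j) • X j : MvPolynomial (Fin N) L) = mAct (idm (rM ρ) χ) (X i) :=
    (mAct_X _ _).symm
  rw [e2, ← AlgHom.comp_apply, mAct_comp]
  have e3 : idm (rM ρ) χ * tor (rM ρ) χ t = t • idm (rM ρ) χ := by
    simp only [tor, mul_add, mul_smul_comm, idm_mul_idm_self hc, idm_mul_idm_ne _ _ _ h, mul_one]
    module
  rw [e3]
  exact (linX i).map_smul _ _
end P2
section P3
variable {k L G : Type} [Field k] [Field L] {N : ℕ}

lemma fAct_algebraMap (M : GL (Fin N) k) (p : MvPolynomial (Fin N) k) :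
    fAct M (algebraMap _ (FractionRing (MvPolynomial (Fin N) k)) p) =
      algebraMap _ (FractionRing (MvPolynomial (Fin N) k))
        (mAct (M : Matrix (Fin N) (Fin N) k) p) :=
  IsFractionRing.ringEquivOfRingEquiv_algebraMap _ _

lemma fAct_ext (e₁ e₂ : FractionRing (MvPolynomial (Fin N) k) →+* FractionRing (MvPolynomial (Fin N) k))
    (h : ∀ p, e₁ (algebraMap (MvPolynomial (Fin N) k) _ p) = e₂ (algebraMap (MvPolynomial (Fin N) k) _ p)) : e₁ = e₂ := by
  ext z
  obtain ⟨a, b, _, rfl⟩ := IsFractionRing.div_surjective (A := MvPolynomial (Fin N) k) z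
  simp [h]

noncomputable def fHom [CommGroup G] (ρ : G →* GL (Fin N) k) :
    G →* (FractionRing (MvPolynomial (Fin N) k) ≃+* FractionRing (MvPolynomial (Fin N) k)) where
  toFun g := fAct (ρ g)
  map_one' := by
    have := fAct_ext (fAct (ρ (1 : G))).toRingHom (RingHom.id _) (by
      intro p
      change fAct _ _ = _
      rw [fAct_algebraMap, map_one, Units.val_one, mAct_one]; rfl)
    ext z
    exact DFunLike.congr_fun this z
  map_mul' a b := by
    have := fAct_ext (fAct (ρ (a * b))).toRingHom
      ((fAct (ρ a)).toRingHom.comp (fAct (ρ b)).toRingHom) (by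
      intro p
      change fAct _ _ = fAct _ (fAct _ _)
      rw [fAct_algebraMap, fAct_algebraMap, fAct_algebraMap, mul_comm a b, map_mul, Units.val_mul,
        ← mAct_comp]; rfl)
    ext z
    exact DFunLike.congr_fun this z

lemma totalDegree_mAct_le (M : Matrix (Fin N) (Fin N) k) (p : MvPolynomial (Fin N) k) :
    (mAct M p).totalDegree ≤ p.totalDegree := by
  have hX : ∀ i, (∑ j, C (M i j) * X j : MvPolynomial (Fin N) k).totalDegree ≤ 1 := by
    intro i
    apply totalDegree_finsetSum_le
    intro j _
    refine (totalDegree_mul _ _).trans ?_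
    simp [totalDegree_C, totalDegree_X]
  unfold mAct
  rw [aeval_def, eval₂_eq]
  apply totalDegree_finsetSum_le
  intro d hd
  refine (totalDegree_mul _ _).trans ?_
  rw [algebraMap_eq, totalDegree_C, zero_add]
  refine (totalDegree_finsetProd _ _).trans ?_
  refine le_trans ?_ (le_totalDegree hd)
  apply Finset.sum_le_sum
  intro i _
  refine (totalDegree_pow _ _).trans ?_
  exact (Nat.mul_le_mul_left _ (hX i)).trans (by simp)

lemma mAct_inj (M : GL (Fin N) k) : Function.Injective (mAct (M : Matrix (Fin N) (Fin N) k)) :=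
  (mEquiv M).injective

lemma semi (M : GL (Fin N) k) (f₁ f₂ : MvPolynomial (Fin N) k) (h1 : f₁ ≠ 0) (h2 : f₂ ≠ 0)
    (hr : IsRelPrime f₁ f₂)
    (hi : fAct M (algebraMap _ (FractionRing (MvPolynomial (Fin N) k)) f₁ / algebraMap _ _ f₂) =
      algebraMap _ (FractionRing (MvPolynomial (Fin N) k)) f₁ / algebraMap _ _ f₂) :
    ∃ c : k, mAct (M : Matrix (Fin N) (Fin N) k) f₁ = c • f₁ ∧
      mAct (M : Matrix (Fin N) (Fin N) k) f₂ = c • f₂ := by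
  have hinj := IsFractionRing.injective (MvPolynomial (Fin N) k)
    (FractionRing (MvPolynomial (Fin N) k))
  have h2' : mAct (M : Matrix (Fin N) (Fin N) k) f₂ ≠ 0 :=
    (map_ne_zero_iff _ (mAct_inj M)).2 h2
  have h1' : mAct (M : Matrix (Fin N) (Fin N) k) f₁ ≠ 0 :=
    (map_ne_zero_iff _ (mAct_inj M)).2 h1
  rw [map_div₀, fAct_algebraMap, fAct_algebraMap, div_eq_div_iff
    ((map_ne_zero_iff _ hinj).2 h2') ((map_ne_zero_iff _ hinj).2 h2), ← map_mul, ← map_mul] at hi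
  replace hi := hinj hi
  obtain ⟨q, hq⟩ : f₁ ∣ mAct (M : Matrix (Fin N) (Fin N) k) f₁ :=
    hr.dvd_of_dvd_mul_right ⟨_, hi⟩
  have hq0 : q ≠ 0 := by rintro rfl; rw [mul_zero] at hq; exact h1' hq
  have hd := totalDegree_mAct_le (M : Matrix (Fin N) (Fin N) k) f₁
  rw [hq, totalDegree_mul_of_isDomain h1 hq0] at hd
  have hq1 : q.totalDegree = 0 := by omega
  rw [totalDegree_eq_zero_iff_eq_C] at hq1
  refine ⟨coeff 0 q, ?_, ?_⟩
  · rw [hq, smul_eq_C_mul, ← hq1, mul_comm]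
  · rw [smul_eq_C_mul, ← hq1]
    apply mul_left_cancel₀ h1
    rw [← hi, hq]; ring

variable [Algebra k L]

lemma mAct_map (M : Matrix (Fin N) (Fin N) k) (p : MvPolynomial (Fin N) k) :
    mAct (M.map (algebraMap k L)) (map (algebraMap k L) p) = map (algebraMap k L) (mAct M p) := by
  have : ((mAct (M.map (algebraMap k L))).toRingHom.comp (map (algebraMap k L))) =
    (map (algebraMap k L)).comp (mAct M).toRingHom := by
    apply MvPolynomial.ringHom_ext
    · intro r
      simp [mAct]
    · intro i
      simp [mAct]
  exact DFunLike.congr_fun this p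

variable (k L N) in
noncomputable def iot : FractionRing (MvPolynomial (Fin N) k) →+* FractionRing (MvPolynomial (Fin N) L) :=
  IsFractionRing.lift (A := MvPolynomial (Fin N) k)
    (g := (algebraMap (MvPolynomial (Fin N) L) _).comp (map (algebraMap k L)))
    ((IsFractionRing.injective (MvPolynomial (Fin N) L) _).comp
      (map_injective _ (algebraMap k L).injective))

lemma iot_algebraMap (p : MvPolynomial (Fin N) k) :
    iot k L N (algebraMap _ _ p) = algebraMap (MvPolynomial (Fin N) L) _ (map (algebraMap k L) p) :=
  IsFractionRing.lift_algebraMap _ _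

variable [CommGroup G] [Fintype G]

noncomputable def rhoL (ρ : G →* GL (Fin N) k) : G →* GL (Fin N) L :=
  (Matrix.GeneralLinearGroup.map (algebraMap k L)).comp ρ

lemma key_fixed (hc : (Fintype.card G : L) ≠ 0) (ρ : G →* GL (Fin N) k) (χ : G →* Lˣ)
    (h : χ ≠ χ⁻¹) (t : Lˣ) (f : FractionRing (MvPolynomial (Fin N) k))
    (hi : IsInv (fun g => ρ g) f) (hd : RDegLE f 2) :
    fAct (torGL hc (rhoL ρ) χ h t) (iot k L N f) = iot k L N f := by
  obtain ⟨f₁, f₂, h2, hr, rfl, hdeg⟩ := hd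
  by_cases h1 : f₁ = 0
  · simp [h1]
  have hr' : IsRelPrime f₁ f₂ := fun p => hr p
  choose c hc1 hc2 using fun g => semi (ρ g) f₁ f₂ h1 h2 hr' (hi g)
  have hinj := IsFractionRing.injective (MvPolynomial (Fin N) L)
    (FractionRing (MvPolynomial (Fin N) L))
  have act : ∀ (p : MvPolynomial (Fin N) k) (g : G) (c : k),
      mAct (ρ g : Matrix (Fin N) (Fin N) k) p = c • p →
      mAct ((rhoL ρ g : GL (Fin N) L) : Matrix (Fin N) (Fin N) L) (map (algebraMap k L) p) =
        algebraMap k L c • map (algebraMap k L) p := by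
    intro p g c hp
    change mAct ((ρ g : Matrix (Fin N) (Fin N) k).map (algebraMap k L)) _ = _
    rw [mAct_map, hp, smul_eq_C_mul, smul_eq_C_mul, map_mul, map_C]
  have main : ∃ l : L,
      mAct (tor (rM (rhoL ρ)) χ (t : L)) (map (algebraMap k L) f₁) =
        l • map (algebraMap k L) f₁ ∧
      mAct (tor (rM (rhoL ρ)) χ (t : L)) (map (algebraMap k L) f₂) =
        l • map (algebraMap k L) f₂ := by
    have hm : ∀ p : MvPolynomial (Fin N) k,
      (map (algebraMap k L) p).totalDegree ≤ p.totalDegree := fun p =>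
      Finset.sup_mono (support_map_subset _ _)
    have e1 := hm f₁
    have e2 := hm f₂
    by_cases hlin : f₁.totalDegree ≤ 1 ∧ f₂.totalDegree ≤ 1
    · obtain ⟨l, hl⟩ := tor_semi (rhoL ρ) χ h (t : L) (fun g => algebraMap k L (c g))
      exact ⟨l, hl _ (by omega) (fun g => act _ _ _ (hc1 g)),
        hl _ (by omega) (fun g => act _ _ _ (hc2 g))⟩
    · have hc0 : ∀ g, c g = 1 := by
        have key : ∀ p : MvPolynomial (Fin N) k, p ≠ 0 → p.totalDegree = 0 →
            (∀ g, mAct (ρ g : Matrix (Fin N) (Fin N) k) p = c g • p) → ∀ g, c g = 1 := by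
          intro p hp hp0 hh g
          have := hh g
          rw [totalDegree_eq_zero_iff_eq_C] at hp0
          have e : mAct (ρ g : Matrix (Fin N) (Fin N) k) p = p := by
            rw [hp0]; simp [mAct]
          rw [e] at this
          have h3 : (1 - c g) • p = 0 := by rw [sub_smul, one_smul, ← this, sub_self]
          rcases smul_eq_zero.1 h3 with h4 | h4
          · exact (sub_eq_zero.1 h4).symm
          · exact absurd h4 hp
        by_cases h0 : f₁.totalDegree = 0
        · exact key f₁ h1 h0 hc1
        · exact key f₂ h2 (by omega) hc2
      refine ⟨1, ?_, ?_⟩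
      · rw [one_smul]
        refine tor_inv hc _ χ h _ t.ne_zero _ (by omega) ?_
        intro g
        rw [act _ _ _ (hc1 g), hc0, map_one, one_smul]
      · rw [one_smul]
        refine tor_inv hc _ χ h _ t.ne_zero _ (by omega) ?_
        intro g
        rw [act _ _ _ (hc2 g), hc0, map_one, one_smul]
  obtain ⟨l, hl1, hl2⟩ := main
  have hl1' : mAct (torGL hc (rhoL ρ) χ h t : Matrix (Fin N) (Fin N) L) (map (algebraMap k L) f₁) =
        l • map (algebraMap k L) f₁ := hl1
  have hl2' : mAct (torGL hc (rhoL ρ) χ h t : Matrix (Fin N) (Fin N) L) (map (algebraMap k L) f₂) =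
        l • map (algebraMap k L) f₂ := hl2
  have f2ne : map (algebraMap k L) f₂ ≠ 0 :=
    (map_ne_zero_iff _ (map_injective _ (algebraMap k L).injective)).2 h2
  have hl0 : l ≠ 0 := by
    rintro rfl
    rw [zero_smul] at hl2'
    exact (map_ne_zero_iff _ (mAct_inj _)).2 f2ne hl2'
  rw [map_div₀, map_div₀, iot_algebraMap, iot_algebraMap, fAct_algebraMap, fAct_algebraMap, hl1',
    hl2', smul_eq_C_mul, smul_eq_C_mul, map_mul, map_mul, mul_div_mul_left]
  rw [map_ne_zero_iff _ hinj, Ne, C_eq_zero]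
  exact hl0

omit [Algebra k L] in
lemma alg_inv (ρ : G →* GL (Fin N) k) (F : Subring (FractionRing (MvPolynomial (Fin N) k)))
    (hF : ∀ f, IsInv (fun g => ρ g) f → f ∈ F) (x : FractionRing (MvPolynomial (Fin N) k)) :
    IsAlgebraic F x := by
  let _ : MulSemiringAction G (FractionRing (MvPolynomial (Fin N) k)) :=
    MulSemiringAction.compHom _ (fHom ρ)
  have h := (FixedPoints.isIntegral G (FractionRing (MvPolynomial (Fin N) k)) x).isAlgebraic
  let j : FixedPoints.subfield G (FractionRing (MvPolynomial (Fin N) k)) →+* F :=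
    Subring.inclusion (S := (FixedPoints.subfield G
      (FractionRing (MvPolynomial (Fin N) k))).toSubring) (fun z hz => hF z (fun g => hz g))
  refine h.ringHom_of_comp_eq j (RingHom.id (FractionRing (MvPolynomial (Fin N) k))) ?_ ?_
  · intro a b hab
    apply Subtype.ext
    exact congrArg (fun z : F => (z : FractionRing (MvPolynomial (Fin N) k))) hab
  · rfl

omit [Algebra k L] in
lemma gamma_nonempty (ρ : G →* GL (Fin N) k) :
    ∃ d : ℕ, ∃ s : Set (FractionRing (MvPolynomial (Fin N) k)),
    (∀ f ∈ s, IsInv (fun g => ρ g) f ∧ RDegLE f d) ∧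
    AlgebraicIndependent k ((↑) : s → FractionRing (MvPolynomial (Fin N) k)) ∧
    ∀ f, IsInv (fun g => ρ g) f → IsAlgebraic (IntermediateField.adjoin k s) f := by
  have : Algebra.IsAlgebraic (Algebra.adjoin k {f | IsInv (fun g => ρ g) f})
      (FractionRing (MvPolynomial (Fin N) k)) :=
    ⟨fun x => alg_inv ρ (Algebra.adjoin k {f | IsInv (fun g => ρ g) f}).toSubring
      (fun f hf => Algebra.subset_adjoin hf) x⟩
  obtain ⟨s, hs, hb⟩ := exists_isTranscendenceBasis_subset (R := k) {f | IsInv (fun g => ρ g) f}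
  have hfin : s.Finite := by
    have := IsLocalization.isAlgebraic (FractionRing (MvPolynomial (Fin N) k))
      (nonZeroDivisors (MvPolynomial (Fin N) k))
    have hX := (IsTranscendenceBasis.mvPolynomial (Fin N) k).algebraMap_comp
      (A := FractionRing (MvPolynomial (Fin N) k))
    have := hb.cardinalMk_eq hX
    rw [← Cardinal.lt_aleph0_iff_set_finite, this]
    exact Cardinal.mk_lt_aleph0
  have hdeg : ∀ f : FractionRing (MvPolynomial (Fin N) k), ∃ d, RDegLE f d := by
    intro f
    obtain ⟨a, b, hab, rfl⟩ := IsFractionRing.exists_reduced_fraction (MvPolynomial (Fin N) k) f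
    refine ⟨_, a, b, nonZeroDivisors.ne_zero b.2, fun p => @hab p, ?_, le_rfl⟩
    exact IsFractionRing.mk'_eq_div _
  choose D hD using hdeg
  refine ⟨hfin.toFinset.sup D, s, ?_, hb.1, ?_⟩
  · intro f hf
    refine ⟨hs hf, ?_⟩
    obtain ⟨a, b, h1, h2, h3, h4⟩ := hD f
    exact ⟨a, b, h1, h2, h3, h4.trans (Finset.le_sup (f := D) (hfin.mem_toFinset.2 hf))⟩
  · intro f _
    have := hb.isAlgebraic_field
    rw [Subtype.range_coe] at this
    exact this.isAlgebraic f

noncomputable def fixF (T : Lˣ → GL (Fin N) L) : Subfield (FractionRing (MvPolynomial (Fin N) L)) where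
  carrier := {z | ∀ t, fAct (T t) z = z}
  mul_mem' ha hb t := by rw [map_mul, ha t, hb t]
  one_mem' t := map_one _
  add_mem' ha hb t := by rw [map_add, ha t, hb t]
  zero_mem' t := map_zero _
  neg_mem' ha t := by rw [map_neg, ha t]
  inv_mem' z ha t := by rw [map_inv₀, ha t]

omit [Algebra k L] [CommGroup G] [Fintype G] in
lemma not_alg [Infinite L] (T : Lˣ → GL (Fin N) L) (w : FractionRing (MvPolynomial (Fin N) L))
    (hw : w ≠ 0)
    (h : ∀ t : Lˣ, fAct (T t) w = algebraMap (MvPolynomial (Fin N) L) (FractionRing (MvPolynomial (Fin N) L)) (C (t : L)) * w) : ¬ IsAlgebraic (fixF T) w := by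
  rintro ⟨P, hP, hPw⟩
  have hroot : ∀ t : Lˣ, Polynomial.aeval (algebraMap (MvPolynomial (Fin N) L) (FractionRing (MvPolynomial (Fin N) L)) (C (t : L)) * w) P = 0 := by
    intro t
    rw [← h t]
    have := congrArg (fAct (T t)) hPw
    rw [map_zero, Polynomial.aeval_def] at this
    rw [Polynomial.aeval_def, ← this]
    have e := Polynomial.hom_eval₂ P (algebraMap (fixF T) _) (fAct (T t)).toRingHom w
    refine Eq.trans ?_ e.symm
    congr 1
    ext z
    exact (z.2 t).symm
  have hP' : P.map (fixF T).subtype ≠ 0 :=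
    (Polynomial.map_ne_zero_iff (fixF T).subtype_injective).2 hP
  have hfin := Polynomial.finite_setOfPred_isRoot hP'
  have : Infinite Lˣ := by
    have : Infinite {a : L // a ≠ 0} := (Set.finite_singleton (0 : L)).infinite_compl.to_subtype
    exact unitsEquivNeZero.infinite_iff.2 this
  have hinf : (Set.univ : Set Lˣ).Infinite := Set.infinite_univ
  refine hinf (Set.Finite.of_finite_image (f := fun t : Lˣ => algebraMap (MvPolynomial (Fin N) L) (FractionRing (MvPolynomial (Fin N) L)) (C (t : L)) * w) (hfin.subset ?_) ?_)
  · rintro _ ⟨t, _, rfl⟩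
    change Polynomial.eval _ (P.map (fixF T).subtype) = 0
    rw [Polynomial.eval_map]
    exact hroot t
  · intro a _ b _ hab
    have h1 := mul_right_cancel₀ hw hab
    exact Units.ext (C_injective _ _ (IsFractionRing.injective _ _ h1))

lemma main_lemma (hc : (Fintype.card G : L) ≠ 0) [Infinite L] (ρ : G →* GL (Fin N) k) (χ : G →* Lˣ)
    (h : χ ≠ χ⁻¹) (hocc : Occurs (fun g => ρ g) χ)
    (s : Set (FractionRing (MvPolynomial (Fin N) k)))
    (hs : ∀ f ∈ s, IsInv (fun g => ρ g) f ∧ RDegLE f 2)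
    (ha : ∀ f, IsInv (fun g => ρ g) f → IsAlgebraic (IntermediateField.adjoin k s) f) : False := by
  obtain ⟨v, hv, hev⟩ := hocc
  obtain ⟨u, hu, hut⟩ := exists_weight hc (rhoL ρ) χ h v hv hev
  let T : Lˣ → GL (Fin N) L := torGL hc (rhoL ρ) χ h
  have hCmem : ∀ a : L, algebraMap (MvPolynomial (Fin N) L) _ (C a) ∈ fixF T := by
    intro a t
    rw [fAct_algebraMap]
    congr 1
    simp [mAct]
  let w : MvPolynomial (Fin N) L := ∑ j, u j • X j
  have hw : w ≠ 0 := by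
    intro hw
    apply hu
    ext i
    have := congrArg (coeff (Finsupp.single i 1)) hw
    simpa [w, coeff_sum, coeff_smul, coeff_X, Finsupp.single_left_inj] using this
  refine not_alg T (algebraMap _ _ w) ?_ ?_ ?_
  · exact (map_ne_zero_iff _ (IsFractionRing.injective _ _)).2 hw
  · intro t
    rw [fAct_algebraMap, ← map_mul, ← smul_eq_C_mul]
    congr 1
    exact hut t
  -- algebraicity
  have hAlg : ∀ x : FractionRing (MvPolynomial (Fin N) k),
      IsAlgebraic (IntermediateField.adjoin k s) x := by
    let E := algebraicClosure (IntermediateField.adjoin k s) (FractionRing (MvPolynomial (Fin N) k))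
    intro x
    have h1 : IsAlgebraic E x := alg_inv ρ E.toSubfield.toSubring (fun f hf => by
      exact (mem_algebraicClosure_iff).2 (ha f hf)) x
    exact h1.restrictScalars (IntermediateField.adjoin k s)
  have hsub : IntermediateField.adjoin k s ≤
      ({ (fixF T).comap (iot k L N) with
        algebraMap_mem' := fun a => by
          change iot k L N (algebraMap k _ a) ∈ fixF T
          rw [IsScalarTower.algebraMap_apply k (MvPolynomial (Fin N) k), iot_algebraMap,
            algebraMap_eq, map_C]
          exact hCmem _ } : IntermediateField k (FractionRing (MvPolynomial (Fin N) k))) := by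
    rw [IntermediateField.adjoin_le_iff]
    intro f hf
    exact fun t => key_fixed hc ρ χ h t f (hs f hf).1 (hs f hf).2
  let j : IntermediateField.adjoin k s →+* fixF T :=
    ((iot k L N).comp (algebraMap (IntermediateField.adjoin k s) _)).codRestrict (fixF T)
      (fun z => hsub z.2)
  have hXalg : ∀ i, IsAlgebraic (fixF T) (algebraMap (MvPolynomial (Fin N) L)
      (FractionRing (MvPolynomial (Fin N) L)) (X i)) := by
    intro i
    have := (hAlg (algebraMap (MvPolynomial (Fin N) k) _ (X i))).ringHom_of_comp_eq j (iot k L N) j.injective (by rfl)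
    rwa [iot_algebraMap, map_X] at this
  have : algebraMap (MvPolynomial (Fin N) L) (FractionRing (MvPolynomial (Fin N) L)) w ∈
      algebraicClosure (fixF T) (FractionRing (MvPolynomial (Fin N) L)) := by
    simp only [w, map_sum]
    apply sum_mem
    intro i _
    rw [smul_eq_C_mul, map_mul]
    refine mul_mem ?_ ((mem_algebraicClosure_iff).2 (hXalg i))
    exact (algebraicClosure (fixF T) (FractionRing (MvPolynomial (Fin N) L))).algebraMap_mem
      ⟨_, hCmem (u i)⟩
  exact (mem_algebraicClosure_iff).1 this
end P3

/-- If the number `m` of distinct nontrivial characters occurring in the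
base change of a nontrivial representation `V` to an algebraic closure exceeds the number `τ`
of involutions of the finite abelian group `G` (in nonmodular characteristic), then
`γ^r(G,V) ≥ 3`. -/
theorem stmt14 {k : Type} [Field k] {N : ℕ} {G : Type} [CommGroup G] [Fintype G]
    (hchar : (Fintype.card G : k) ≠ 0) (ρ : G →* GL (Fin N) k)
    (hnontriv : ∃ g, ρ g ≠ 1) (m τ : ℕ)
    (hm : {χ : G →* (AlgebraicClosure k)ˣ | χ ≠ 1 ∧ Occurs (fun g => ρ g) χ}.ncard = m)
    (hτ : {g : G | orderOf g = 2}.ncard = τ)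
    (hmτ : τ < m) :
    3 ≤ gammaR (fun g => ρ g) := by
  have hchar' : (Fintype.card G : AlgebraicClosure k) ≠ 0 := by
    rw [← map_natCast (algebraMap k (AlgebraicClosure k))]
    exact (map_ne_zero (algebraMap k (AlgebraicClosure k))).2 hchar
  obtain ⟨χ, hχ, hne⟩ := exists_char hchar {χ | Occurs (fun g => ρ g) χ} (by
    rw [hτ]
    exact hmτ.trans_le hm.ge)
  by_contra hlt
  have hmem := Nat.sInf_mem (gamma_nonempty ρ)
  obtain ⟨s, hs, -, ha⟩ := hmem
  refine main_lemma hchar' ρ χ hne hχ s ?_ ha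
  intro f hf
  obtain ⟨h1, a, b, h2, h3, h4, h5⟩ := hs f hf
  refine ⟨h1, a, b, h2, h3, h4, h5.trans ?_⟩
  change gammaR (fun g => ρ g) ≤ 2
  omega
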